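/- arXiv:2505.24596 — 11 statements merged into one kernel-verified Lean document; each statement's English description precedes it below -/
import Mathlib

section
/- Fix reals ω_A, ω_B > 0 and set g = 2/(ω_A + ω_B). Define f : (0,∞) → ℝ by f(x) = (g·x + 2)·log₂((g·x + 2)/2) − (g·x)·log₂((g·x)/2). Then f is strictly increasing on (0,∞), and for every real a > 1 one has f((a − 1)(ω_A + ω_B)/2) = (a + 1)·log₂((a + 1)/2) − (a − 1)·log₂((a − 1)/2). Hence the ergotropic gap Δε_pure = (a − 1)(ω_A + ω_B)/2 of a pure two-mode Gaussian state is mapped by a strictly increasing function onto its quantum mutual information I(A:B) = (a + 1)·log₂((a + 1)/2) − (a − 1)·log₂((a − 1)/2). -/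
theorem aux_hasDerivAt (t : ℝ) (ht : 0 < t) :
    HasDerivAt (fun t : ℝ => (t + 2) * Real.log ((t + 2) / 2) - t * Real.log (t / 2))
      (Real.log ((t + 2) / 2) - Real.log (t / 2)) t := by
  have h1 : HasDerivAt (fun t : ℝ => t + 2) 1 t := (hasDerivAt_id t).add_const 2
  have h0 : HasDerivAt (fun t : ℝ => t) 1 t := hasDerivAt_id t
  have h2 := h1.mul ((h1.div_const 2).log (by positivity))
  have h3 := h0.mul ((h0.div_const 2).log (by positivity))
  refine (h2.sub h3).congr_deriv ?_
  field_simp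
  ring

theorem aux_strictMono :
    StrictMonoOn (fun t : ℝ => (t + 2) * Real.log ((t + 2) / 2) - t * Real.log (t / 2))
      (Set.Ioi (0 : ℝ)) := by
  apply strictMonoOn_of_deriv_pos (convex_Ioi 0)
  · intro t ht
    exact (aux_hasDerivAt t ht).continuousAt.continuousWithinAt
  · intro t ht
    rw [interior_Ioi] at ht
    have ht' : 0 < t := ht
    rw [(aux_hasDerivAt t ht).deriv]
    have := Real.log_lt_log (show 0 < t / 2 by positivity)
      (show t / 2 < (t + 2) / 2 by linarith)
    linarith

/-- With `g = 2/(ω_A+ω_B)`, the function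
`f(x) = (gx+2)·log₂((gx+2)/2) − (gx)·log₂((gx)/2)` is strictly increasing on `(0,∞)`,
and for every `a > 1` it maps the ergotropic gap `(a−1)(ω_A+ω_B)/2` of a pure two-mode
Gaussian state to its quantum mutual information
`(a+1)·log₂((a+1)/2) − (a−1)·log₂((a−1)/2)`. -/
theorem gap_maps_to_mutual_info (ωA ωB : ℝ) (hA : 0 < ωA) (hB : 0 < ωB) :
    let g : ℝ := 2 / (ωA + ωB)
    let f : ℝ → ℝ := fun x =>
      (g * x + 2) * Real.logb 2 ((g * x + 2) / 2) - (g * x) * Real.logb 2 ((g * x) / 2)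
    StrictMonoOn f (Set.Ioi (0 : ℝ)) ∧
      ∀ a : ℝ, 1 < a →
        f ((a - 1) * (ωA + ωB) / 2) =
          (a + 1) * Real.logb 2 ((a + 1) / 2) - (a - 1) * Real.logb 2 ((a - 1) / 2) := by
  intro g f
  have hg : 0 < g := by positivity
  refine ⟨?_, ?_⟩
  · intro x hx y hy hxy
    have hx' : 0 < x := hx
    have hy' : 0 < y := hy
    have h := aux_strictMono (show g * x ∈ Set.Ioi (0 : ℝ) from mul_pos hg hx')
      (show g * y ∈ Set.Ioi (0 : ℝ) from mul_pos hg hy') (mul_lt_mul_of_pos_left hxy hg)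
    have h2 : 0 < Real.log 2 := Real.log_pos (by norm_num)
    have key := div_lt_div_of_pos_right h h2
    simp only [f, Real.logb]
    simp only [sub_div, mul_div_assoc] at key ⊢
    exact key
  · intro a ha
    have hs : g * ((a - 1) * (ωA + ωB) / 2) = a - 1 := by
      simp only [g]
      field_simp
    simp only [f, hs]
    rw [show a - 1 + 2 = a + 1 by ring]
end

section
/- Fix a real r and define h : (1,∞) → ℝ by h(x) = ((x+1)/2)·log₂((x+1)/2) − ((x−1)/2)·log₂((x−1)/2). Then the quantum mutual information of the two-mode squeezed thermal state, I(k) = 2·h(k·cosh(2r)) − 2·h(k), tends to 2·log₂(cosh(2r)) as k → ∞ (limit along the filter atTop on ℝ). -/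
open Filter Topology in
theorem tms_aux : Tendsto (fun x : ℝ =>
      ((x + 1) / 2) * Real.logb 2 ((x + 1) / 2) - ((x - 1) / 2) * Real.logb 2 ((x - 1) / 2)
        - Real.logb 2 x) atTop (𝓝 ((1 - Real.log 2) / Real.log 2)) := by
  have hA := Real.tendsto_mul_log_one_add_div_atTop 1
  have hB := Real.tendsto_mul_log_one_add_div_atTop (-1)
  have hl : ∀ t : ℝ, Tendsto (fun x : ℝ => Real.log (1 + t / x)) atTop (𝓝 0) := by
    intro t
    have h1 : Tendsto (fun x : ℝ => 1 + t / x) atTop (𝓝 1) := by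
      simpa using (tendsto_const_nhds (x := (1 : ℝ))).add
        ((tendsto_const_nhds (x := t)).div_atTop tendsto_id)
    simpa using h1.log one_ne_zero
  have key := ((((((hA.add (hl 1)).sub hB).add (hl (-1))).div_const 2).sub_const
    (Real.log 2)).div_const (Real.log 2))
  have e : ((1 + 0 - -1 + 0) / 2 - Real.log 2) / Real.log 2
      = (1 - Real.log 2) / Real.log 2 := by norm_num
  rw [e] at key
  refine key.congr' ?_
  filter_upwards [eventually_gt_atTop 1] with x hx
  have h0 : x ≠ 0 := by positivity
  have hd : 0 < x - 1 := by linarith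
  have ea : 1 + 1 / x = (x + 1) / x := by field_simp
  have eb : 1 + -1 / x = (x - 1) / x := by field_simp; ring
  have hp : x + 1 ≠ 0 := by positivity
  have h2 : Real.log 2 ≠ 0 := (Real.log_pos (by norm_num)).ne'
  simp only [Real.logb]
  rw [ea, eb, Real.log_div hp h0, Real.log_div hd.ne' h0, Real.log_div hp two_ne_zero,
    Real.log_div hd.ne' two_ne_zero]
  field_simp
  ring

/-- The quantum mutual information `I(k) = 2h(k·cosh 2r) − 2h(k)` of the two-mode
squeezed thermal state, with `h(x) = ((x+1)/2)log₂((x+1)/2) − ((x−1)/2)log₂((x−1)/2)`,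
tends to `2·log₂(cosh 2r)` as `k → ∞`. -/
theorem tms_mutual_info_limit (r : ℝ) :
    let h : ℝ → ℝ := fun x =>
      ((x + 1) / 2) * Real.logb 2 ((x + 1) / 2) - ((x - 1) / 2) * Real.logb 2 ((x - 1) / 2)
    Filter.Tendsto (fun k : ℝ => 2 * h (k * Real.cosh (2 * r)) - 2 * h k)
      Filter.atTop (nhds (2 * Real.logb 2 (Real.cosh (2 * r)))) := by
  intro h
  have hc : 0 < Real.cosh (2 * r) := Real.cosh_pos _
  have h1 : Filter.Tendsto (fun x => h x - Real.logb 2 x) Filter.atTop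
      (nhds ((1 - Real.log 2) / Real.log 2)) := tms_aux
  have h2 := h1.comp (Filter.tendsto_id.atTop_mul_const hc)
  have h3 := ((h2.sub h1).const_mul 2).add_const (2 * Real.logb 2 (Real.cosh (2 * r)))
  rw [sub_self, mul_zero, zero_add] at h3
  refine h3.congr' ?_
  filter_upwards [Filter.eventually_gt_atTop 0] with k hk
  simp only [Function.comp, id]
  rw [Real.logb_mul hk.ne' hc.ne']
  ring
end

section
/- Let k, γ, α, θ, z_A, z_B be reals with k ≥ γ ≥ 0, α ≥ 1 and z_A, z_B > 0. Set Z = z_A/z_B + z_B/z_A, F₁ = (k+γ)²cos⁴θ + (k−γ)²sin⁴θ + (k²−γ²)cos²θ·sin²θ·Z and F₂ = (k−γ)²cos⁴θ + (k+γ)²sin⁴θ + (k²−γ²)cos²θ·sin²θ·Z. Then √F₁ + α·√F₂ ≥ (k+γ) + α·(k−γ). Hence the local passive energy of any two-mode Gaussian state is at least its global passive energy, i.e. the Gaussian ergotropic gap is nonnegative. -/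
/-- For Bloch–Messiah parameters `k ≥ γ ≥ 0`, `α ≥ 1`, `z_A, z_B > 0` of a two-mode
Gaussian state, `√F₁ + α√F₂ ≥ (k+γ) + α(k−γ)`: the local passive energy is at least
the global passive energy, i.e. the Gaussian ergotropic gap is nonnegative. -/
theorem local_passive_ge_global_passive (k γ α θ zA zB : ℝ)
    (hγ : 0 ≤ γ) (hkγ : γ ≤ k) (hα : 1 ≤ α) (hzA : 0 < zA) (hzB : 0 < zB) :
    let Z : ℝ := zA / zB + zB / zA
    let F₁ : ℝ := (k + γ) ^ 2 * Real.cos θ ^ 4 + (k - γ) ^ 2 * Real.sin θ ^ 4 +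
      (k ^ 2 - γ ^ 2) * Real.cos θ ^ 2 * Real.sin θ ^ 2 * Z
    let F₂ : ℝ := (k - γ) ^ 2 * Real.cos θ ^ 4 + (k + γ) ^ 2 * Real.sin θ ^ 4 +
      (k ^ 2 - γ ^ 2) * Real.cos θ ^ 2 * Real.sin θ ^ 2 * Z
    Real.sqrt F₁ + α * Real.sqrt F₂ ≥ (k + γ) + α * (k - γ) := by
  intro Z F₁ F₂
  have hZ : 2 ≤ Z := by
    have h : Z - 2 = (zA - zB) ^ 2 / (zA * zB) := by
      simp only [Z]
      field_simp
      ring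
    have h2 : 0 ≤ (zA - zB) ^ 2 / (zA * zB) := by positivity
    linarith
  have hcs := Real.sin_sq_add_cos_sq θ
  have hc : Real.cos θ ^ 2 = 1 - Real.sin θ ^ 2 := by linarith
  have hp : 0 ≤ (k ^ 2 - γ ^ 2) * Real.cos θ ^ 2 * Real.sin θ ^ 2 * (Z - 2) := by
    have h1 : 0 ≤ k ^ 2 - γ ^ 2 := by nlinarith
    have h2 : 0 ≤ Z - 2 := by linarith
    positivity
  have h1 : (k + γ) * Real.cos θ ^ 2 + (k - γ) * Real.sin θ ^ 2 ≤ Real.sqrt F₁ := by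
    apply Real.le_sqrt_of_sq_le
    simp only [F₁]
    linarith
  have h2 : (k - γ) * Real.cos θ ^ 2 + (k + γ) * Real.sin θ ^ 2 ≤ Real.sqrt F₂ := by
    apply Real.le_sqrt_of_sq_le
    simp only [F₂]
    linarith
  have h3 := mul_le_mul_of_nonneg_left h2 (by linarith : (0 : ℝ) ≤ α)
  have h4 : 0 ≤ (α - 1) * (γ * Real.sin θ ^ 2) :=
    mul_nonneg (by linarith) (by positivity)
  rw [hc] at h1 h3
  linarith
end

section
/- Let k_A ≥ k_B ≥ 1, θ ∈ ℝ and z_A, z_B > 0 be reals. Define the 4×4 real matrices V = diag(k_A, k_A, k_B, k_B), S(u,v) = diag(u, 1/u, v, 1/v) for u,v > 0, and B(θ) with 2×2 blocks cosθ·I₂ on the diagonal, sinθ·I₂ in the upper-right and −sinθ·I₂ in the lower-left. Let σ = B(θ)·S(√z_A,√z_B)·V·S(√z_A,√z_B)ᵀ·B(θ)ᵀ, and let r_A = [ (k_A z_B cos²θ + k_B z_A sin²θ) / (z_A z_B (k_A z_A cos²θ + k_B z_B sin²θ)) ]^{1/4}, r_B = [ (k_B z_A cos²θ + k_A z_B sin²θ)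 / (z_A z_B (k_B z_B cos²θ + k_A z_A sin²θ)) ]^{1/4}. Then M = S(r_A, r_B)·σ·S(r_A, r_B)ᵀ is in standard form: M₁₂ = M₂₁ = M₃₄ = M₄₃ = M₁₄ = M₄₁ = M₂₃ = M₃₂ = 0, M₁₁ = M₂₂ = √F₁ and M₃₃ = M₄₄ = √F₂, where, with k = (k_A+k_B)/2, γ = (k_A−k_B)/2 and Z = z_A/z_B + z_B/z_A, F₁ = (k+γ)²cos⁴θ + (k−γ)²sin⁴θ + (k²−γ²)cos²θ sin²θ·Z and F₂ = (k−γ)²cos⁴θ + (k+γ)²sin⁴θ + (k²−γ²)cos²θ sin²θ·Z. -/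
open Matrix

/-- Thermal fluctuation matrix `V = diag(k_A, k_A, k_B, k_B)`. -/
def Vmat (kA kB : ℝ) : Matrix (Fin 4) (Fin 4) ℝ :=
  !![kA, 0, 0, 0; 0, kA, 0, 0; 0, 0, kB, 0; 0, 0, 0, kB]

/-- Local squeezing matrix `S(u,v) = diag(u, 1/u, v, 1/v)`. -/
noncomputable def Smat (u v : ℝ) : Matrix (Fin 4) (Fin 4) ℝ :=
  !![u, 0, 0, 0; 0, 1 / u, 0, 0; 0, 0, v, 0; 0, 0, 0, 1 / v]

/-- Beam splitter matrix `B(θ)` with blocks `cosθ·I₂`, `±sinθ·I₂`. -/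
noncomputable def Bmat (θ : ℝ) : Matrix (Fin 4) (Fin 4) ℝ :=
  !![Real.cos θ, 0, Real.sin θ, 0;
     0, Real.cos θ, 0, Real.sin θ;
     -Real.sin θ, 0, Real.cos θ, 0;
     0, -Real.sin θ, 0, Real.cos θ]

lemma quarter_aux (x y w t : ℝ) (hx : 0 < x) (hy : 0 < y) (ht : t = y / x) (hw : w = x * y) :
    (t ^ ((1 : ℝ) / 4)) ^ 2 * x = Real.sqrt w ∧
    ((t ^ ((1 : ℝ) / 4))⁻¹) ^ 2 * y = Real.sqrt w := by
  subst ht hw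
  have hr : 0 < (y / x) ^ ((1 : ℝ) / 4) := Real.rpow_pos_of_pos (div_pos hy hx) _
  have h4 : ((y / x) ^ ((1 : ℝ) / 4)) ^ 4 = y / x := by
    rw [← Real.rpow_natCast, ← Real.rpow_mul (div_pos hy hx).le]; norm_num
  generalize (y / x) ^ ((1 : ℝ) / 4) = r at hr h4
  have hy' : y = r ^ 4 * x := by rw [h4]; field_simp
  have h : Real.sqrt (x * y) = r ^ 2 * x := by
    rw [Real.sqrt_eq_iff_mul_self_eq (by positivity) (by positivity), hy']; ring
  refine ⟨h.symm, ?_⟩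
  rw [h, hy']; field_simp

lemma pos_aux (a b θ : ℝ) (ha : 0 < a) (hb : 0 < b) :
    0 < a * Real.cos θ ^ 2 + b * Real.sin θ ^ 2 := by
  have h := Real.sin_sq_add_cos_sq θ
  rcases eq_or_ne (Real.cos θ) 0 with h0 | h0
  · have : Real.sin θ ^ 2 = 1 := by rw [h0] at h; linarith
    rw [h0, this]; linarith
  · positivity

/-- The local squeezing `S(r_A, r_B)` with the stated optimal parameters brings the
Bloch–Messiah covariance matrix `σ = B S V Sᵀ Bᵀ` to standard form, with diagonal
blocks `√F₁·I₂`, `√F₂·I₂` and vanishing stated off-diagonal entries. -/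
theorem squeezing_to_standard_form (kA kB θ zA zB : ℝ)
    (hkB : 1 ≤ kB) (hkAB : kB ≤ kA) (hzA : 0 < zA) (hzB : 0 < zB) :
    let σ : Matrix (Fin 4) (Fin 4) ℝ :=
      Bmat θ * Smat (Real.sqrt zA) (Real.sqrt zB) * Vmat kA kB *
        (Smat (Real.sqrt zA) (Real.sqrt zB))ᵀ * (Bmat θ)ᵀ
    let rA : ℝ := ((kA * zB * Real.cos θ ^ 2 + kB * zA * Real.sin θ ^ 2) /
      (zA * zB * (kA * zA * Real.cos θ ^ 2 + kB * zB * Real.sin θ ^ 2))) ^ ((1 : ℝ) / 4)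
    let rB : ℝ := ((kB * zA * Real.cos θ ^ 2 + kA * zB * Real.sin θ ^ 2) /
      (zA * zB * (kB * zB * Real.cos θ ^ 2 + kA * zA * Real.sin θ ^ 2))) ^ ((1 : ℝ) / 4)
    let M : Matrix (Fin 4) (Fin 4) ℝ := Smat rA rB * σ * (Smat rA rB)ᵀ
    let k : ℝ := (kA + kB) / 2
    let γ : ℝ := (kA - kB) / 2
    let Z : ℝ := zA / zB + zB / zA
    let F₁ : ℝ := (k + γ) ^ 2 * Real.cos θ ^ 4 + (k - γ) ^ 2 * Real.sin θ ^ 4 +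
      (k ^ 2 - γ ^ 2) * Real.cos θ ^ 2 * Real.sin θ ^ 2 * Z
    let F₂ : ℝ := (k - γ) ^ 2 * Real.cos θ ^ 4 + (k + γ) ^ 2 * Real.sin θ ^ 4 +
      (k ^ 2 - γ ^ 2) * Real.cos θ ^ 2 * Real.sin θ ^ 2 * Z
    M 0 1 = 0 ∧ M 1 0 = 0 ∧ M 2 3 = 0 ∧ M 3 2 = 0 ∧
      M 0 3 = 0 ∧ M 3 0 = 0 ∧ M 1 2 = 0 ∧ M 2 1 = 0 ∧
      M 0 0 = Real.sqrt F₁ ∧ M 1 1 = Real.sqrt F₁ ∧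
      M 2 2 = Real.sqrt F₂ ∧ M 3 3 = Real.sqrt F₂ := by
  intro σ rA rB M k γ Z F₁ F₂
  have hB : 0 < kB := by linarith
  have hA : 0 < kA := by linarith
  have p1 := pos_aux (kA * zA) (kB * zB) θ (by positivity) (by positivity)
  have p2 := pos_aux (kA / zA) (kB / zB) θ (by positivity) (by positivity)
  have p3 := pos_aux (kB * zB) (kA * zA) θ (by positivity) (by positivity)
  have p4 := pos_aux (kB / zB) (kA / zA) θ (by positivity) (by positivity)
  have h1 := quarter_aux _ _ F₁ ((kA * zB * Real.cos θ ^ 2 + kB * zA * Real.sin θ ^ 2) /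
      (zA * zB * (kA * zA * Real.cos θ ^ 2 + kB * zB * Real.sin θ ^ 2))) p1 p2
      (by rw [div_eq_div_iff (by positivity) (by positivity)]; field_simp)
      (by simp only [F₁, Z, k, γ]; field_simp; ring)
  have h2 := quarter_aux _ _ F₂ ((kB * zA * Real.cos θ ^ 2 + kA * zB * Real.sin θ ^ 2) /
      (zA * zB * (kB * zB * Real.cos θ ^ 2 + kA * zA * Real.sin θ ^ 2))) p3 p4
      (by rw [div_eq_div_iff (by positivity) (by positivity)]; field_simp)
      (by simp only [F₂, Z, k, γ]; field_simp; ring)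
  change rA ^ 2 * _ = _ ∧ rA⁻¹ ^ 2 * _ = _ at h1
  change rB ^ 2 * _ = _ ∧ rB⁻¹ ^ 2 * _ = _ at h2
  obtain ⟨h1a, h1b⟩ := h1
  obtain ⟨h2a, h2b⟩ := h2
  have qA : Real.sqrt zA ^ 2 = zA := Real.sq_sqrt hzA.le
  have qB : Real.sqrt zB ^ 2 = zB := Real.sq_sqrt hzB.le
  have iA : (Real.sqrt zA)⁻¹ ^ 2 = zA⁻¹ := by rw [inv_pow, qA]
  have iB : (Real.sqrt zB)⁻¹ ^ 2 = zB⁻¹ := by rw [inv_pow, qB]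
  rw [← h1a, ← h2a]
  refine ⟨?_, ?_, ?_, ?_, ?_, ?_, ?_, ?_, ?_, ?_, ?_, ?_⟩
  on_goal 10 => rw [h1a, ← h1b]
  on_goal 12 => rw [h2a, ← h2b]
  all_goals
    clear_value rA rB F₁ F₂
    simp only [M, σ, Smat, Bmat, Vmat, Matrix.mul_apply, Fin.sum_univ_four, Matrix.transpose_apply]
    simp [-inv_pow]
  · linear_combination rA ^ 2 * kA * Real.cos θ ^ 2 * qA + rA ^ 2 * kB * Real.sin θ ^ 2 * qB
  · linear_combination rA⁻¹ ^ 2 * kA * Real.cos θ ^ 2 * iA + rA⁻¹ ^ 2 * kB * Real.sin θ ^ 2 * iB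
  · linear_combination rB ^ 2 * kA * Real.sin θ ^ 2 * qA + rB ^ 2 * kB * Real.cos θ ^ 2 * qB
  · linear_combination rB⁻¹ ^ 2 * kA * Real.sin θ ^ 2 * iA + rB⁻¹ ^ 2 * kB * Real.cos θ ^ 2 * iB
end

section
/- Let k_A ≥ k_B ≥ 1, θ ∈ ℝ and z_A, z_B > 0 be reals, and let σ = B(θ)·S(√z_A,√z_B)·V·S(√z_A,√z_B)ᵀ·B(θ)ᵀ with V = diag(k_A,k_A,k_B,k_B), S(u,v) = diag(u,1/u,v,1/v), and B(θ) the 4×4 matrix with blocks cosθ·I₂ on the diagonal, sinθ·I₂ upper-right and −sinθ·I₂ lower-left. Write σ in 2×2 blocks as [[σ_A, σ_AB],[σ_ABᵀ, σ_B]]. Then, with k = (k_A+k_B)/2, γ = (k_A−k_B)/2 and Z = z_A/z_B + z_B/z_A, the PPT quantity satisfies det σ − det σ_A − det σ_B + 2·det σ_AB + 1 = (1 + k⁴ − 2k²γ² + γ⁴ − 2k² − 2γ²) − 4cos²θ·sin²θ·[(k² − γ²)·Z − 2(k² + γ²)]. -/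
open Matrix

/-- Entrywise form of the covariance matrix. -/
noncomputable def sigmaExplicit (kA kB c s x y : ℝ) : Matrix (Fin 4) (Fin 4) ℝ :=
  !![c ^ 2 * kA * x + s ^ 2 * kB * y, 0, c * s * (kB * y - kA * x), 0;
     0, c ^ 2 * kA * x⁻¹ + s ^ 2 * kB * y⁻¹, 0, c * s * (kB * y⁻¹ - kA * x⁻¹);
     c * s * (kB * y - kA * x), 0, s ^ 2 * kA * x + c ^ 2 * kB * y, 0;
     0, c * s * (kB * y⁻¹ - kA * x⁻¹), 0, s ^ 2 * kA * x⁻¹ + c ^ 2 * kB * y⁻¹]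

theorem sigma_eq (kA kB θ u v : ℝ) :
    Bmat θ * Smat u v * Vmat kA kB * (Smat u v)ᵀ * (Bmat θ)ᵀ =
      sigmaExplicit kA kB (Real.cos θ) (Real.sin θ) (u * u) (v * v) := by
  ext i j
  fin_cases i <;> fin_cases j <;>
    simp [Bmat, Smat, Vmat, sigmaExplicit, Matrix.mul_apply, Matrix.vecMul, dotProduct,
      Fin.sum_univ_succ] <;> try ring

/-- For the Bloch–Messiah covariance matrix `σ = B S V Sᵀ Bᵀ` of a general two-mode
Gaussian state, the PPT quantity `det σ − det σ_A − det σ_B + 2 det σ_AB + 1` equals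
`(1 + k⁴ − 2k²γ² + γ⁴ − 2k² − 2γ²) − 4cos²θ sin²θ[(k²−γ²)Z − 2(k²+γ²)]`. -/
theorem ppt_quantity_bloch_messiah (kA kB θ zA zB : ℝ)
    (hkB : 1 ≤ kB) (hkAB : kB ≤ kA) (hzA : 0 < zA) (hzB : 0 < zB) :
    let σ : Matrix (Fin 4) (Fin 4) ℝ :=
      Bmat θ * Smat (Real.sqrt zA) (Real.sqrt zB) * Vmat kA kB *
        (Smat (Real.sqrt zA) (Real.sqrt zB))ᵀ * (Bmat θ)ᵀ
    let σA : Matrix (Fin 2) (Fin 2) ℝ := !![σ 0 0, σ 0 1; σ 1 0, σ 1 1]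
    let σB : Matrix (Fin 2) (Fin 2) ℝ := !![σ 2 2, σ 2 3; σ 3 2, σ 3 3]
    let σAB : Matrix (Fin 2) (Fin 2) ℝ := !![σ 0 2, σ 0 3; σ 1 2, σ 1 3]
    let k : ℝ := (kA + kB) / 2
    let γ : ℝ := (kA - kB) / 2
    let Z : ℝ := zA / zB + zB / zA
    σ.det - σA.det - σB.det + 2 * σAB.det + 1 =
      (1 + k ^ 4 - 2 * k ^ 2 * γ ^ 2 + γ ^ 4 - 2 * k ^ 2 - 2 * γ ^ 2) -
        4 * Real.cos θ ^ 2 * Real.sin θ ^ 2 *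
          ((k ^ 2 - γ ^ 2) * Z - 2 * (k ^ 2 + γ ^ 2)) := by
  have hA : Real.sqrt zA * Real.sqrt zA = zA := Real.mul_self_sqrt hzA.le
  have hB : Real.sqrt zB * Real.sqrt zB = zB := Real.mul_self_sqrt hzB.le
  have hcs := Real.sin_sq_add_cos_sq θ
  intro σ
  have hσ : σ = sigmaExplicit kA kB (Real.cos θ) (Real.sin θ) zA zB := by
    have hA0 : Real.sqrt zA ≠ 0 := (Real.sqrt_pos.2 hzA).ne'
    have hB0 : Real.sqrt zB ≠ 0 := (Real.sqrt_pos.2 hzB).ne'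
    have h := sigma_eq kA kB θ (Real.sqrt zA) (Real.sqrt zB)
    rw [hA, hB] at h
    exact h
  have hdet : σ.det = kA ^ 2 * kB ^ 2 := by
    have hu : (Real.sqrt zA) ≠ 0 := (Real.sqrt_pos.2 hzA).ne'
    have hv : (Real.sqrt zB) ≠ 0 := (Real.sqrt_pos.2 hzB).ne'
    have h1 : (Bmat θ).det = 1 := by
      simp [Bmat, Matrix.det_succ_row_zero, Fin.sum_univ_succ, Fin.succAbove]
      linear_combination (Real.sin θ ^ 2 + Real.cos θ ^ 2 + 1) * hcs
    have h2 : (Smat (Real.sqrt zA) (Real.sqrt zB)).det = 1 := by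
      simp [Smat, Matrix.det_succ_row_zero, Fin.sum_univ_succ, Fin.succAbove]
      field_simp
    have h3 : (Vmat kA kB).det = kA ^ 2 * kB ^ 2 := by
      simp [Vmat, Matrix.det_succ_row_zero, Fin.sum_univ_succ, Fin.succAbove]
      ring
    simp only [σ, Matrix.det_mul, Matrix.det_transpose, h1, h2, h3]
    ring
  intro σA σB σAB k γ Z
  rw [hdet]
  simp only [σA, σB, σAB, hσ, Matrix.det_fin_two_of, k, γ, Z, sigmaExplicit]
  simp
  have hc : Real.cos θ ^ 2 = 1 - Real.sin θ ^ 2 := by linarith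
  generalize Real.cos θ = c at *
  generalize Real.sin θ = s at *
  have e1 : zA * zA⁻¹ = 1 := mul_inv_cancel₀ hzA.ne'
  have e2 : zB * zB⁻¹ = 1 := mul_inv_cancel₀ hzB.ne'
  simp only [div_eq_mul_inv]
  generalize zA⁻¹ = a at *
  generalize zB⁻¹ = b at *
  linear_combination (-(c^4 + s^4 - 2*c^2*s^2) * kA^2) * e1 + (-(c^4 + s^4 - 2*c^2*s^2) * kB^2) * e2 - (kA^2 + kB^2) * (c^2 + s^2 + 1) * hcs
end

section
/- (Theorem 2a.) Let k, γ, α, θ, z_A, z_B be reals with k ≥ γ ≥ 0, k − γ ≥ 1, α ≥ 1, z_A, z_B > 0, and (k−1)(1+α) + γ(1−α) > 0. Set Z = z_A/z_B + z_B/z_A, F₁ = (k+γ)²cos⁴θ + (k−γ)²sin⁴θ + (k²−γ²)cos²θ sin²θ·Z, F₂ = (k−γ)²cos⁴θ + (k+γ)²sin⁴θ + (k²−γ²)cos²θ sin²θ·Z, and Δ = [ −(k(1+α)+γ(1−α)) + √F₁ + α√F₂ ] / [ (k−1)(1+α)+γ(1−α) ]. If the separability condition 1 + k⁴ − 2k²γ²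 + γ⁴ − 2k² − 2γ² ≥ 4cos²θ sin²θ·[(k²−γ²)Z − 2(k²+γ²)] holds, then Δ ≤ [ −(k(1+α)+γ(1−α)) + ((1+α)/2)·√(1 + k⁴ + γ⁴ + 2k² + 2γ² − 2k²γ² + 8kγ) ] / [ (k−1)(1+α)+γ(1−α) ]. -/
/-- Theorem 2(a): if the Bloch–Messiah parameters of a two-mode Gaussian state satisfy
the PPT separability condition, then its relative ergotropic gap `Δ` is bounded above
by the separable bound `B^sep_max(k,γ,α)`. -/
theorem rel_ergotropic_gap_separable_bound (k γ α θ zA zB : ℝ)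
    (hγ : 0 ≤ γ) (hγk : γ ≤ k) (hk : 1 ≤ k - γ) (hα : 1 ≤ α)
    (hzA : 0 < zA) (hzB : 0 < zB)
    (hden : 0 < (k - 1) * (1 + α) + γ * (1 - α)) :
    let Z : ℝ := zA / zB + zB / zA
    let F₁ : ℝ := (k + γ) ^ 2 * Real.cos θ ^ 4 + (k - γ) ^ 2 * Real.sin θ ^ 4 +
      (k ^ 2 - γ ^ 2) * Real.cos θ ^ 2 * Real.sin θ ^ 2 * Z
    let F₂ : ℝ := (k - γ) ^ 2 * Real.cos θ ^ 4 + (k + γ) ^ 2 * Real.sin θ ^ 4 +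
      (k ^ 2 - γ ^ 2) * Real.cos θ ^ 2 * Real.sin θ ^ 2 * Z
    let Δ : ℝ := (-(k * (1 + α) + γ * (1 - α)) + Real.sqrt F₁ + α * Real.sqrt F₂) /
      ((k - 1) * (1 + α) + γ * (1 - α))
    (1 + k ^ 4 - 2 * k ^ 2 * γ ^ 2 + γ ^ 4 - 2 * k ^ 2 - 2 * γ ^ 2 ≥
        4 * Real.cos θ ^ 2 * Real.sin θ ^ 2 *
          ((k ^ 2 - γ ^ 2) * Z - 2 * (k ^ 2 + γ ^ 2))) →
      Δ ≤ (-(k * (1 + α) + γ * (1 - α)) + ((1 + α) / 2) *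
            Real.sqrt (1 + k ^ 4 + γ ^ 4 + 2 * k ^ 2 + 2 * γ ^ 2 -
              2 * k ^ 2 * γ ^ 2 + 8 * k * γ)) /
          ((k - 1) * (1 + α) + γ * (1 - α)) := by
  intro Z F₁ F₂ Δ hsep
  have hcs : Real.sin θ ^ 2 = 1 - Real.cos θ ^ 2 := by
    have := Real.sin_sq_add_cos_sq θ
    linarith
  have hc0 : 0 ≤ Real.cos θ ^ 2 := sq_nonneg _
  have hs0 : 0 ≤ 1 - Real.cos θ ^ 2 := hcs ▸ sq_nonneg (Real.sin θ)
  have hs4 : Real.sin θ ^ 4 = (1 - Real.cos θ ^ 2) ^ 2 := by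
    rw [← hcs]; ring
  have hc4 : Real.cos θ ^ 4 = (Real.cos θ ^ 2) ^ 2 := by ring
  rw [hcs] at hsep
  have hkg : 0 ≤ k * γ := mul_nonneg (by linarith) hγ
  set B : ℝ := 1 + k ^ 4 + γ ^ 4 + 2 * k ^ 2 + 2 * γ ^ 2 - 2 * k ^ 2 * γ ^ 2 + 8 * k * γ with hB
  have half : Real.sqrt (B / 4) = Real.sqrt B / 2 := by
    rw [Real.sqrt_div' _ (by norm_num : (0 : ℝ) ≤ 4)]
    congr 1
    rw [show (4 : ℝ) = 2 ^ 2 by norm_num]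
    exact Real.sqrt_sq (by norm_num)
  have h1 : F₁ ≤ B / 4 := by
    simp only [F₁, hB]
    rw [hs4, hc4, hcs]
    nlinarith [mul_nonneg hkg hs0]
  have h2 : F₂ ≤ B / 4 := by
    simp only [F₂, hB]
    rw [hs4, hc4, hcs]
    nlinarith [mul_nonneg hkg hc0]
  have g1 := Real.sqrt_le_sqrt h1
  have g2 := Real.sqrt_le_sqrt h2
  rw [half] at g1 g2
  have g3 := mul_le_mul_of_nonneg_left g2 (by linarith : (0 : ℝ) ≤ α)
  apply div_le_div_of_nonneg_right _ hden.le
  linarith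
end

section
/- (Theorem 2b.) Let k, γ, α, θ, z_A, z_B be reals with k ≥ γ ≥ 0, k − γ ≥ 1, α ≥ 1, z_A, z_B > 0, and (k−1)(1+α) + γ(1−α) > 0. Set Z = z_A/z_B + z_B/z_A, F₁ = (k+γ)²cos⁴θ + (k−γ)²sin⁴θ + (k²−γ²)cos²θ sin²θ·Z, F₂ = (k−γ)²cos⁴θ + (k+γ)²sin⁴θ + (k²−γ²)cos²θ sin²θ·Z, and Δ = [ −(k(1+α)+γ(1−α)) + √F₁ + α√F₂ ] / [ (k−1)(1+α)+γ(1−α) ]. If the entanglement condition 1 + k⁴ − 2k²γ² + γ⁴ − 2k² − 2γ² < 4cos²θ sin²θ·[(k²−γ²)Z − 2(k²+γ²)] holds, then Δ > [ −(k(1+α)+γ(1−α)) + ((1+α)/2)·√(1 + k⁴ + γ⁴ + 2k² + 2γ² − 2k²γ² − 8kγ) ] / [ (k−1)(1+α)+γ(1−α) ]. -/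
/-- Theorem 2(b): if the Bloch–Messiah parameters of a two-mode Gaussian state violate
the PPT separability condition (i.e. the state is entangled), then its relative
ergotropic gap `Δ` is bounded below by the entangled bound `B^ent_min(k,γ,α)`. -/
theorem rel_ergotropic_gap_entangled_bound (k γ α θ zA zB : ℝ)
    (hγ : 0 ≤ γ) (hγk : γ ≤ k) (hk : 1 ≤ k - γ) (hα : 1 ≤ α)
    (hzA : 0 < zA) (hzB : 0 < zB)
    (hden : 0 < (k - 1) * (1 + α) + γ * (1 - α)) :
    let Z : ℝ := zA / zB + zB / zA
    let F₁ : ℝ := (k + γ) ^ 2 * Real.cos θ ^ 4 + (k - γ) ^ 2 * Real.sin θ ^ 4 +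
      (k ^ 2 - γ ^ 2) * Real.cos θ ^ 2 * Real.sin θ ^ 2 * Z
    let F₂ : ℝ := (k - γ) ^ 2 * Real.cos θ ^ 4 + (k + γ) ^ 2 * Real.sin θ ^ 4 +
      (k ^ 2 - γ ^ 2) * Real.cos θ ^ 2 * Real.sin θ ^ 2 * Z
    let Δ : ℝ := (-(k * (1 + α) + γ * (1 - α)) + Real.sqrt F₁ + α * Real.sqrt F₂) /
      ((k - 1) * (1 + α) + γ * (1 - α))
    (1 + k ^ 4 - 2 * k ^ 2 * γ ^ 2 + γ ^ 4 - 2 * k ^ 2 - 2 * γ ^ 2 <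
        4 * Real.cos θ ^ 2 * Real.sin θ ^ 2 *
          ((k ^ 2 - γ ^ 2) * Z - 2 * (k ^ 2 + γ ^ 2))) →
      Δ > (-(k * (1 + α) + γ * (1 - α)) + ((1 + α) / 2) *
            Real.sqrt (1 + k ^ 4 + γ ^ 4 + 2 * k ^ 2 + 2 * γ ^ 2 -
              2 * k ^ 2 * γ ^ 2 - 8 * k * γ)) /
          ((k - 1) * (1 + α) + γ * (1 - α)) := by
  intro Z F₁ F₂ Δ h
  have hcs : Real.sin θ ^ 2 = 1 - Real.cos θ ^ 2 := by
    have := Real.sin_sq_add_cos_sq θ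
    linarith
  have hc0 : 0 ≤ Real.cos θ ^ 2 := sq_nonneg _
  have hs0 : 0 ≤ 1 - Real.cos θ ^ 2 := hcs ▸ sq_nonneg (Real.sin θ)
  have hkγ : 0 ≤ k * γ := mul_nonneg (by linarith) hγ
  have h1 := mul_nonneg hkγ hc0
  have h2 := mul_nonneg hkγ hs0
  set M : ℝ := 1 + k ^ 4 + γ ^ 4 + 2 * k ^ 2 + 2 * γ ^ 2 - 2 * k ^ 2 * γ ^ 2 - 8 * k * γ with hM
  have hM0 : 0 ≤ M := by
    have hu : 0 ≤ (k - γ) ^ 2 - 1 := by nlinarith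
    have := mul_nonneg hu (sq_nonneg (k + γ))
    nlinarith [sq_nonneg (k - γ)]
  have e4 : Real.sin θ ^ 4 = (1 - Real.cos θ ^ 2) ^ 2 := by rw [← hcs]; ring
  have hF1 : M < 4 * F₁ := by
    simp only [F₁, hM]
    rw [e4, hcs]
    rw [hcs] at h
    nlinarith
  have hF2 : M < 4 * F₂ := by
    simp only [F₂, hM]
    rw [e4, hcs]
    rw [hcs] at h
    nlinarith
  have key : ∀ F : ℝ, M < 4 * F → Real.sqrt M / 2 < Real.sqrt F := by
    intro F hF
    apply Real.lt_sqrt_of_sq_lt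
    have := Real.sq_sqrt hM0
    nlinarith
  have k1 := key _ hF1
  have k2 := key _ hF2
  have k3 : α * (Real.sqrt M / 2) < α * Real.sqrt F₂ :=
    mul_lt_mul_of_pos_left k2 (by linarith)
  simp only [Δ, gt_iff_lt]
  apply div_lt_div_of_pos_right _ hden
  linarith
end

section
/- Let k ≥ γ ≥ 0 be reals with k − γ ≥ 1. Then 1 + k⁴ + γ⁴ + 2k² + 2γ² − 2k²γ² ≥ 8kγ (indeed the difference equals (k+γ)²((k−γ)²−1) + 3(k−γ)² + 1 ≥ 0). Consequently, for every α ≥ 1 with (k−1)(1+α)+γ(1−α) > 0, the entangled bound B^ent_min(k,γ,α) = [ −(k(1+α)+γ(1−α)) + ((1+α)/2)√(1+k⁴+γ⁴+2k²+2γ²−2k²γ² − 8kγ) ] / [ (k−1)(1+α)+γ(1−α) ] is well-defined and satisfies B^ent_min(k,γ,α) ≤ B^sep_max(k,γ,α), where B^sep_max is the same expression with +8kγ in place of −8kγ. -/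
/-- For `k ≥ γ ≥ 0` with `k − γ ≥ 1`, one has
`1 + k⁴ + γ⁴ + 2k² + 2γ² − 2k²γ² ≥ 8kγ`, with the difference equal to
`(k+γ)²((k−γ)²−1) + 3(k−γ)² + 1 ≥ 0`; consequently for every `α ≥ 1` with
`(k−1)(1+α)+γ(1−α) > 0` the entangled bound `B^ent_min` is well-defined (nonnegative
radicand) and satisfies `B^ent_min(k,γ,α) ≤ B^sep_max(k,γ,α)`. -/
theorem ent_bound_le_sep_bound (k γ : ℝ) (hγ : 0 ≤ γ) (hγk : γ ≤ k) (hk : 1 ≤ k - γ) :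
    (1 + k ^ 4 + γ ^ 4 + 2 * k ^ 2 + 2 * γ ^ 2 - 2 * k ^ 2 * γ ^ 2 ≥ 8 * k * γ) ∧
    (1 + k ^ 4 + γ ^ 4 + 2 * k ^ 2 + 2 * γ ^ 2 - 2 * k ^ 2 * γ ^ 2 - 8 * k * γ =
      (k + γ) ^ 2 * ((k - γ) ^ 2 - 1) + 3 * (k - γ) ^ 2 + 1) ∧
    ((k + γ) ^ 2 * ((k - γ) ^ 2 - 1) + 3 * (k - γ) ^ 2 + 1 ≥ 0) ∧
    ∀ α : ℝ, 1 ≤ α → 0 < (k - 1) * (1 + α) + γ * (1 - α) →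
      (0 ≤ 1 + k ^ 4 + γ ^ 4 + 2 * k ^ 2 + 2 * γ ^ 2 - 2 * k ^ 2 * γ ^ 2 - 8 * k * γ) ∧
      (-(k * (1 + α) + γ * (1 - α)) + ((1 + α) / 2) *
          Real.sqrt (1 + k ^ 4 + γ ^ 4 + 2 * k ^ 2 + 2 * γ ^ 2 -
            2 * k ^ 2 * γ ^ 2 - 8 * k * γ)) /
        ((k - 1) * (1 + α) + γ * (1 - α)) ≤
      (-(k * (1 + α) + γ * (1 - α)) + ((1 + α) / 2) *
          Real.sqrt (1 + k ^ 4 + γ ^ 4 + 2 * k ^ 2 + 2 * γ ^ 2 -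
            2 * k ^ 2 * γ ^ 2 + 8 * k * γ)) /
        ((k - 1) * (1 + α) + γ * (1 - α)) := by
  have hid : 1 + k ^ 4 + γ ^ 4 + 2 * k ^ 2 + 2 * γ ^ 2 - 2 * k ^ 2 * γ ^ 2 - 8 * k * γ =
      (k + γ) ^ 2 * ((k - γ) ^ 2 - 1) + 3 * (k - γ) ^ 2 + 1 := by ring
  have h1 : 0 ≤ (k - γ) ^ 2 - 1 := by nlinarith
  have hnn : (k + γ) ^ 2 * ((k - γ) ^ 2 - 1) + 3 * (k - γ) ^ 2 + 1 ≥ 0 := by positivity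
  have hk0 : 0 ≤ k * γ := mul_nonneg (hγ.trans hγk) hγ
  refine ⟨by linarith, hid, hnn, fun α hα hpos => ⟨by linarith, ?_⟩⟩
  refine div_le_div_of_nonneg_right ?_ hpos.le
  refine add_le_add le_rfl (mul_le_mul_of_nonneg_left (Real.sqrt_le_sqrt ?_) (by linarith))
  linarith
end

section
/- (Corollary 1.) Let k > 1, α ≥ 1, θ ∈ ℝ and z_A, z_B > 0 be reals, and set Z = z_A/z_B + z_B/z_A and F = k²(cos⁴θ + sin⁴θ + cos²θ sin²θ·Z). Then the relative ergotropic gap at equal fluctuation factors, Δ = (√F − k)/(k − 1), satisfies Δ ≤ (k−1)/2 if and only if (k² − 1)² ≥ 4cos²θ·sin²θ·k²·(Z − 2); moreover the separable bound at γ = 0 equals B^sep_max(k,0,α) = (k−1)/2. Hence for two-mode Gaussian states with equal fluctuation factors in both modes, Δ ≤ B^sep_max is a necessary and sufficient condition for separability. -/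
/-- Corollary 1: for two-mode Gaussian states with equal fluctuation factors (`γ = 0`),
the relative ergotropic gap `Δ = (√F − k)/(k−1)` satisfies `Δ ≤ (k−1)/2` if and only if
the PPT separability condition `(k²−1)² ≥ 4cos²θ sin²θ k²(Z−2)` holds; moreover the
separable bound at `γ = 0` equals `(k−1)/2`. Hence `Δ ≤ B^sep_max` is necessary and
sufficient for separability. -/
theorem rel_gap_iff_separable_equal_fluctuations (k α θ zA zB : ℝ)
    (hk : 1 < k) (hα : 1 ≤ α) (hzA : 0 < zA) (hzB : 0 < zB) :
    let Z : ℝ := zA / zB + zB / zA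
    let F : ℝ := k ^ 2 * (Real.cos θ ^ 4 + Real.sin θ ^ 4 +
      Real.cos θ ^ 2 * Real.sin θ ^ 2 * Z)
    let Δ : ℝ := (Real.sqrt F - k) / (k - 1)
    (Δ ≤ (k - 1) / 2 ↔
      (k ^ 2 - 1) ^ 2 ≥ 4 * Real.cos θ ^ 2 * Real.sin θ ^ 2 * k ^ 2 * (Z - 2)) ∧
    (-(k * (1 + α)) + ((1 + α) / 2) * Real.sqrt (1 + k ^ 4 + 2 * k ^ 2)) /
        ((k - 1) * (1 + α)) = (k - 1) / 2 := by
  intro Z F Δ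
  have hk1 : 0 < k - 1 := by linarith
  have hF : F = k ^ 2 + Real.cos θ ^ 2 * Real.sin θ ^ 2 * k ^ 2 * (Z - 2) := by
    have h : Real.cos θ ^ 2 = 1 - Real.sin θ ^ 2 := Real.cos_sq' θ
    have h4 : Real.cos θ ^ 4 = (1 - Real.sin θ ^ 2) ^ 2 := by rw [← h]; ring
    simp only [F]
    rw [h4, h]
    ring
  refine ⟨?_, ?_⟩
  · have h1 : Δ ≤ (k - 1) / 2 ↔ Real.sqrt F ≤ (k ^ 2 + 1) / 2 := by
      simp only [Δ]
      rw [div_le_iff₀ hk1]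
      constructor <;> intro h <;> nlinarith
    rw [h1, Real.sqrt_le_left (by positivity), hF]
    constructor <;> intro h <;> nlinarith
  · have h2 : Real.sqrt (1 + k ^ 4 + 2 * k ^ 2) = k ^ 2 + 1 := by
      rw [show 1 + k ^ 4 + 2 * k ^ 2 = (k ^ 2 + 1) ^ 2 by ring]
      exact Real.sqrt_sq (by positivity)
    have h3 : (1 + α) ≠ 0 := by linarith
    rw [h2, div_eq_iff (mul_ne_zero hk1.ne' h3)]
    ring
end

section
/- (Lemma 2.) Define f, g : ℝ⁴ → ℝ on the open set U = {(a,b,ν₊,ν₋) : a > 1, b > 1, ν₊ > 1, ν₋ > 1} by f(a,b,ν₊,ν₋) = (a + b − ν₊ − ν₋)/(ν₊ + ν₋ − 2) and g(a,b,ν₊,ν₋) = (1/2)[H(a) + H(b) − H(ν₊) − H(ν₋)], where H(x) = (x+1)·log₂((x+1)/2) − (x−1)·log₂((x−1)/2). Then at every point of U with a ≠ b, the functions f and g are differentiable and their total derivatives (gradients) are linearly independent: there exist no reals c₁, c₂, not both zero, with c₁·∇f + c₂·∇g = 0 at that point. Hence the relative ergotropic gap and the quantum mutual information are functionally independent quantities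 on two-mode Gaussian states. -/
/-- `H(x) = (x+1)·log₂((x+1)/2) − (x−1)·log₂((x−1)/2)`. -/
noncomputable def Hent (x : ℝ) : ℝ :=
  (x + 1) * Real.logb 2 ((x + 1) / 2) - (x - 1) * Real.logb 2 ((x - 1) / 2)

/-- The relative ergotropic gap `f(a,b,ν₊,ν₋) = (a+b−ν₊−ν₋)/(ν₊+ν₋−2)`,
as a function of `(a,b,ν₊,ν₋) = (p 0, p 1, p 2, p 3)`. -/
noncomputable def fREG (p : Fin 4 → ℝ) : ℝ :=
  (p 0 + p 1 - p 2 - p 3) / (p 2 + p 3 - 2)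

/-- The quantum mutual information `g(a,b,ν₊,ν₋) = (1/2)[H(a)+H(b)−H(ν₊)−H(ν₋)]`. -/
noncomputable def gQMI (p : Fin 4 → ℝ) : ℝ :=
  (1 / 2) * (Hent (p 0) + Hent (p 1) - Hent (p 2) - Hent (p 3))

theorem Hent_hasDerivAt (x : ℝ) (hx : 1 < x) :
    HasDerivAt Hent ((Real.log ((x + 1) / 2) - Real.log ((x - 1) / 2)) / Real.log 2) x := by
  have hl : Real.log 2 ≠ 0 := (Real.log_pos (by norm_num)).ne'
  have h1 : HasDerivAt (fun y : ℝ => (y + 1) / 2) (1 / 2) x :=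
    ((hasDerivAt_id x).add_const 1).div_const 2
  have h2 : HasDerivAt (fun y : ℝ => (y - 1) / 2) (1 / 2) x :=
    ((hasDerivAt_id x).sub_const 1).div_const 2
  have p1 : x + 1 ≠ 0 := by linarith
  have p2 : x - 1 ≠ 0 := by linarith
  have l1 := (h1.log (by positivity)).div_const (Real.log 2)
  have l2 := (h2.log (by positivity)).div_const (Real.log 2)
  have k1 := ((hasDerivAt_id x).add_const 1).mul l1
  have k2 := ((hasDerivAt_id x).sub_const 1).mul l2
  have k := k1.sub k2
  refine HasDerivAt.congr_deriv (f := Hent) k ?_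
  simp only [id]
  field_simp
  ring

theorem Hent_deriv_inj (a b : ℝ) (ha : 1 < a) (hb : 1 < b)
    (h : Real.log ((a + 1) / 2) - Real.log ((a - 1) / 2)
      = Real.log ((b + 1) / 2) - Real.log ((b - 1) / 2)) : a = b := by
  have a1 : 0 < (a + 1) / 2 := by linarith
  have a2 : 0 < (a - 1) / 2 := by linarith
  have b1 : 0 < (b + 1) / 2 := by linarith
  have b2 : 0 < (b - 1) / 2 := by linarith
  have h' : Real.log ((a + 1) / 2 * ((b - 1) / 2)) = Real.log ((b + 1) / 2 * ((a - 1) / 2)) := by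
    rw [Real.log_mul a1.ne' b2.ne', Real.log_mul b1.ne' a2.ne']; linarith
  have := Real.log_injOn_pos (mul_pos a1 b2) (mul_pos b1 a2) h'
  linarith

/-- Lemma 2: at every point of `U = {a,b,ν₊,ν₋ > 1}` with `a ≠ b`, the relative
ergotropic gap `f` and the quantum mutual information `g` are differentiable and
their total derivatives are linearly independent; hence the two quantities are
functionally independent on two-mode Gaussian states. -/
theorem reg_qmi_functionally_independent (p : Fin 4 → ℝ)
    (ha : 1 < p 0) (hb : 1 < p 1) (hνp : 1 < p 2) (hνm : 1 < p 3)
    (hab : p 0 ≠ p 1) :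
    DifferentiableAt ℝ fREG p ∧ DifferentiableAt ℝ gQMI p ∧
      ∀ c₁ c₂ : ℝ, ¬(c₁ = 0 ∧ c₂ = 0) →
        c₁ • fderiv ℝ fREG p + c₂ • fderiv ℝ gQMI p ≠ 0 := by
  have pr : ∀ i : Fin 4, HasFDerivAt (fun q : Fin 4 → ℝ => q i)
      (ContinuousLinearMap.proj (R := ℝ) (φ := fun _ : Fin 4 => ℝ) i) p := fun i =>
    hasFDerivAt_apply i p
  have hD : p 2 + p 3 - 2 ≠ 0 := by linarith
  have hl : Real.log 2 ≠ 0 := (Real.log_pos (by norm_num)).ne'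
  have hn := (((pr 0).add (pr 1)).sub (pr 2)).sub (pr 3)
  have hd := ((pr 2).add (pr 3)).sub_const 2
  have df : DifferentiableAt ℝ fREG p :=
    DifferentiableAt.fun_mul (𝔸 := ℝ) (a := fun q : Fin 4 → ℝ => q 0 + q 1 - q 2 - q 3)
      (b := fun q : Fin 4 → ℝ => (q 2 + q 3 - 2)⁻¹)
      hn.differentiableAt (hd.differentiableAt.fun_inv hD)
  have H0 := (Hent_hasDerivAt _ ha).comp_hasFDerivAt p (pr 0)
  have H1 := (Hent_hasDerivAt _ hb).comp_hasFDerivAt p (pr 1)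
  have H2 := (Hent_hasDerivAt _ hνp).comp_hasFDerivAt p (pr 2)
  have H3 := (Hent_hasDerivAt _ hνm).comp_hasFDerivAt p (pr 3)
  have hg0 := (((H0.add H1).sub H2).sub H3).const_mul (1 / 2)
  have hg : HasFDerivAt gQMI _ p := hg0
  refine ⟨df, hg.differentiableAt, ?_⟩
  intro c₁ c₂ hc h
  -- directional derivatives of `fREG` along the first two coordinates
  have key : ∀ v : Fin 4 → ℝ, v 2 = 0 → v 3 = 0 →
      fderiv ℝ fREG p v = (v 0 + v 1) / (p 2 + p 3 - 2) := by
    intro v h2 h3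
    have e1 : HasDerivAt (fun t : ℝ => p + t • v) v 0 := by
      simpa using ((hasDerivAt_id (0 : ℝ)).smul_const v).const_add p
    have e2 : HasDerivAt (fun t : ℝ => fREG (p + t • v)) (fderiv ℝ fREG p v) 0 := by
      have : HasFDerivAt fREG (fderiv ℝ fREG p) (p + (0 : ℝ) • v) := by
        simpa using df.hasFDerivAt
      exact this.comp_hasDerivAt (0 : ℝ) e1
    have e3 : (fun t : ℝ => fREG (p + t • v)) = fun t : ℝ =>
        (t * (v 0 + v 1) + (p 0 + p 1 - p 2 - p 3)) / (p 2 + p 3 - 2) := by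
      funext t
      simp only [fREG, Pi.add_apply, Pi.smul_apply, smul_eq_mul, h2, h3]
      congr 1 <;> ring
    rw [e3] at e2
    have e4 := (((hasDerivAt_id (0 : ℝ)).mul_const (v 0 + v 1)).add_const
      (p 0 + p 1 - p 2 - p 3)).div_const (p 2 + p 3 - 2)
    have := e2.unique e4
    simpa using this
  have x0 := DFunLike.congr_fun h (Pi.single 0 1)
  have x1 := DFunLike.congr_fun h (Pi.single 1 1)
  rw [hg.fderiv] at x0 x1
  simp [key] at x0 x1
  have hne : Real.log ((p 0 + 1) / 2) - Real.log ((p 0 - 1) / 2)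
      - (Real.log ((p 1 + 1) / 2) - Real.log ((p 1 - 1) / 2)) ≠ 0 := fun h0 =>
    hab (Hent_deriv_inj _ _ ha hb (by linarith))
  have hc2 : c₂ = 0 := by
    have : c₂ * (Real.log ((p 0 + 1) / 2) - Real.log ((p 0 - 1) / 2)
      - (Real.log ((p 1 + 1) / 2) - Real.log ((p 1 - 1) / 2))) = 0 := by
      have h4 := add_left_cancel (x0.trans x1.symm)
      field_simp at h4
      linarith
    exact (mul_eq_zero.mp this).resolve_right hne
  subst hc2
  simp [hD] at x0
  exact hc ⟨x0, rfl⟩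
end

section
/- Let k ≥ 1 and r be reals with k·cosh(2r) > 1. Let σ₀ be the 4×4 real matrix with diagonal 2×2 blocks k·cosh(2r)·I₂ and off-diagonal 2×2 blocks diag(k·sinh(2r), −k·sinh(2r)), and let P = diag(1,1,0,0). Then Tr[(σ₀ − I)P] = 2(k·cosh(2r) − 1) ≠ 0, and the matrix σ = σ₀ + 2·(σ₀ − I)·P·(σ₀ − I)/Tr[(σ₀ − I)P] is in standard form with diagonal blocks a·I₂ and b·I₂ and off-diagonal blocks diag(c₁, −c₁), where a = 2k·cosh(2r) − 1, b = k·(k·cosh(4r) − cosh(2r))/(k·cosh(2r) − 1), and c₁ = 2k·sinh(2r). -/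
open Matrix

/-- For the two-mode squeezed thermal covariance matrix `σ₀` (parameters `k ≥ 1`, `r`)
with `k·cosh 2r > 1`, and `P = diag(1,1,0,0)`, one has
`Tr[(σ₀−I)P] = 2(k·cosh 2r − 1) ≠ 0`, and the photon-subtracted covariance matrix
`σ = σ₀ + 2(σ₀−I)P(σ₀−I)/Tr[(σ₀−I)P]` is in standard form with diagonal blocks
`a·I₂`, `b·I₂` and off-diagonal blocks `diag(c₁, −c₁)`, where `a = 2k·cosh 2r − 1`,
`b = k(k·cosh 4r − cosh 2r)/(k·cosh 2r − 1)` and `c₁ = 2k·sinh 2r`. -/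
theorem photon_subtracted_tms_standard_form (k r : ℝ) (hk : 1 ≤ k)
    (h : 1 < k * Real.cosh (2 * r)) :
    let σ0 : Matrix (Fin 4) (Fin 4) ℝ :=
      !![k * Real.cosh (2 * r), 0, k * Real.sinh (2 * r), 0;
         0, k * Real.cosh (2 * r), 0, -(k * Real.sinh (2 * r));
         k * Real.sinh (2 * r), 0, k * Real.cosh (2 * r), 0;
         0, -(k * Real.sinh (2 * r)), 0, k * Real.cosh (2 * r)]
    let P : Matrix (Fin 4) (Fin 4) ℝ :=
      !![1, 0, 0, 0; 0, 1, 0, 0; 0, 0, 0, 0; 0, 0, 0, 0]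
    let t : ℝ := Matrix.trace ((σ0 - 1) * P)
    let σ : Matrix (Fin 4) (Fin 4) ℝ := σ0 + (2 / t) • ((σ0 - 1) * P * (σ0 - 1))
    let a : ℝ := 2 * k * Real.cosh (2 * r) - 1
    let b : ℝ := k * (k * Real.cosh (4 * r) - Real.cosh (2 * r)) /
      (k * Real.cosh (2 * r) - 1)
    let c₁ : ℝ := 2 * k * Real.sinh (2 * r)
    (t = 2 * (k * Real.cosh (2 * r) - 1)) ∧ t ≠ 0 ∧
      σ = !![a, 0, c₁, 0; 0, a, 0, -c₁; c₁, 0, b, 0; 0, -c₁, 0, b] := by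
  intro σ0 P t σ a b c₁
  have ht : t = 2 * (k * Real.cosh (2 * r) - 1) := by
    simp [t, σ0, P, Matrix.trace, Fin.sum_univ_four, Matrix.mul_apply, Matrix.one_apply]
    ring
  have hd : k * Real.cosh (2 * r) - 1 ≠ 0 := by linarith
  have h4 : Real.cosh (4 * r) = Real.cosh (2 * r) ^ 2 + Real.sinh (2 * r) ^ 2 := by
    rw [← Real.cosh_two_mul]; ring_nf
  refine ⟨ht, by rw [ht]; exact mul_ne_zero two_ne_zero hd, ?_⟩
  have h2 : 2 / t = 1 / (k * Real.cosh (2 * r) - 1) := by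
    rw [ht]; field_simp
  simp only [σ, h2, b, h4, a, c₁, σ0, P]
  clear h2 ht h4
  generalize Real.cosh (2 * r) = C at hd ⊢
  generalize Real.sinh (2 * r) = S
  ext i j
  fin_cases i <;> fin_cases j <;>
    simp [Fin.sum_univ_four, Matrix.mul_apply, Matrix.one_apply] <;>
    field_simp <;> ring
end
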